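/- arXiv:0903.5143 — 2 statements merged into one kernel-verified Lean document; each statement's English description precedes it below -/
import Mathlib

section
/- Let d and n be positive integers, and define P ∈ Matrix (Fin n → Fin d) (Fin n → Fin d) ℝ by P(i,j) = ∫_{O(d)} ∏_{k=1}^{n} g_{i(k) j(k)} dg (the matrix of ∫ g^{⊗n} dg in the standard tensor basis). Then P·P = P and Pᵀ = P, i.e. P is an orthogonal projection. If n is odd then P = 0. If n = 2m is even, then the range of P, viewed as a linear endomorphism of ℝ^{Fin n → Fin d}, is exactly the linear span of the vectors ρ(𝔪), 𝔪 ∈ M(2m), where ρ(𝔪) ∈ ℝ^{Fin n → Fin d} has coordinates ρ(𝔪)_i = [i∘𝔪 = i]. -/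
open MeasureTheory

/-- A pair partition of `{1,…,N}` identified with a fixed-point-free involution of `Fin N`. -/
def IsPairMatching {N : ℕ} (m : Equiv.Perm (Fin N)) : Prop :=
  (∀ x, m (m x) = x) ∧ (∀ x, m x ≠ x)

instance {N : ℕ} : DecidablePred (IsPairMatching (N := N)) := fun _ => by
  unfold IsPairMatching; infer_instance

/-- `Matchings N` is the set `M(N)` of pair partitions (fixed-point-free involutions). -/
def Matchings (N : ℕ) : Type := {m : Equiv.Perm (Fin N) // IsPairMatching m}

instance (N : ℕ) : Fintype (Matchings N) := Subtype.fintype _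

/-- The vector `ρ(𝔪)` in `(ℝ^d)^{⊗N} = ℝ^{Fin N → Fin d}`. -/
def rho (d N : ℕ) (m : Matchings N) : (Fin N → Fin d) → ℝ :=
  fun i => if i ∘ ⇑m.1 = i then 1 else 0

/-- The orthogonal group `O(d)`. -/
abbrev OrthGroup (d : ℕ) : Type := Matrix.orthogonalGroup (Fin d) ℝ

noncomputable instance (d : ℕ) : MeasurableSpace (OrthGroup d) := borel _


section TensorPower

variable {d : ℕ} (n : ℕ)

/-- The matrix of `M^{⊗n}` in the standard tensor basis. -/
def tensorPower (M : Matrix (Fin d) (Fin d) ℝ) : Matrix (Fin n → Fin d) (Fin n → Fin d) ℝ :=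
  Matrix.of fun i j => ∏ k, M (i k) (j k)

theorem tensorPower_apply (M : Matrix (Fin d) (Fin d) ℝ) (i j : Fin n → Fin d) :
    tensorPower n M i j = ∏ k, M (i k) (j k) := rfl

theorem tensorPower_mul (M N : Matrix (Fin d) (Fin d) ℝ) :
    tensorPower n (M * N) = tensorPower n M * tensorPower n N := by
  ext i j
  simp only [tensorPower_apply, Matrix.mul_apply, Finset.prod_univ_sum,
    Fintype.piFinset_univ, Finset.prod_mul_distrib]

theorem tensorPower_one : tensorPower n (1 : Matrix (Fin d) (Fin d) ℝ) = 1 := by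
  ext i j
  simp only [tensorPower_apply, Matrix.one_apply, Finset.prod_ite_zero, funext_iff]
  simp

theorem tensorPower_transpose (M : Matrix (Fin d) (Fin d) ℝ) :
    tensorPower n M.transpose = (tensorPower n M).transpose := rfl

theorem tensorPower_neg (M : Matrix (Fin d) (Fin d) ℝ) :
    tensorPower n (-M) = (-1 : ℝ) ^ n • tensorPower n M := by
  ext i j
  simp [tensorPower_apply, Finset.prod_neg]

theorem continuous_tensorPower_apply (i j : Fin n → Fin d) :
    Continuous fun M : Matrix (Fin d) (Fin d) ℝ => tensorPower n M i j := by
  simp only [tensorPower_apply]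
  fun_prop

/-- The vectors of `(ℝ^d)^{⊗n}` fixed by `g^{⊗n}` for every orthogonal `g`. -/
def orthInvariants (d : ℕ) : Submodule ℝ ((Fin n → Fin d) → ℝ) where
  carrier := {T | ∀ g : OrthGroup d, (tensorPower n g.1).mulVec T = T}
  add_mem' ha hb g := by rw [Matrix.mulVec_add, ha g, hb g]
  zero_mem' g := Matrix.mulVec_zero _
  smul_mem' c T hT g := by rw [Matrix.mulVec_smul, hT g]

end TensorPower

section Nonneg

open Matrix

variable {d n : ℕ}

theorem dotProduct_tensorPower_mulVec_nonneg_of_posSemidef {S : Matrix (Fin d) (Fin d) ℝ}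
    (hS : S.PosSemidef) (T : (Fin n → Fin d) → ℝ) :
    0 ≤ T ⬝ᵥ (tensorPower n S *ᵥ T) := by
  obtain ⟨B, rfl⟩ : ∃ B : Matrix (Fin d) (Fin d) ℝ, S = Bᵀ * B := by
    open scoped MatrixOrder in
    refine ⟨CFC.sqrt S, ?_⟩
    have h := (CFC.sqrt_nonneg S).posSemidef.1
    rw [IsHermitian, conjTranspose_eq_transpose_of_trivial] at h
    rw [h, CFC.sqrt_mul_sqrt_self S hS.nonneg]
  rw [tensorPower_mul, tensorPower_transpose, ← mulVec_mulVec, dotProduct_mulVec,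
    vecMul_transpose]
  exact Finset.sum_nonneg fun i _ => mul_self_nonneg _

theorem exists_orthogonal_mul_posSemidef {G : Matrix (Fin d) (Fin d) ℝ} (hG : IsUnit G) :
    ∃ O : OrthGroup d, ∃ S : Matrix (Fin d) (Fin d) ℝ, S.PosSemidef ∧ G = O.1 * S := by
  open scoped MatrixOrder in
  have hpos : (Gᵀ * G).PosSemidef := by
    simpa [conjTranspose_eq_transpose_of_trivial] using posSemidef_conjTranspose_mul_self G
  set S := CFC.sqrt (Gᵀ * G)
  have hSS : S * S = Gᵀ * G := CFC.sqrt_mul_sqrt_self _ hpos.nonneg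
  have hS : S.PosSemidef := (CFC.sqrt_nonneg (Gᵀ * G)).posSemidef
  have hSt : Sᵀ = S := by
    have h := hS.1
    rwa [IsHermitian, conjTranspose_eq_transpose_of_trivial] at h
  have hGd : IsUnit G.det := (isUnit_iff_isUnit_det G).1 hG
  have hSd : IsUnit S.det := by
    have h := congrArg det hSS
    rw [det_mul, det_mul, det_transpose] at h
    exact isUnit_of_mul_isUnit_left (h ▸ hGd.mul hGd)
  refine ⟨⟨G * S⁻¹, ?_⟩, S, hS, ?_⟩
  · rw [mem_orthogonalGroup_iff']
    change (G * S⁻¹)ᵀ * (G * S⁻¹) = 1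
    rw [transpose_mul, transpose_nonsing_inv, hSt, Matrix.mul_assoc, ← Matrix.mul_assoc Gᵀ, ← hSS,
      Matrix.mul_assoc S S, mul_nonsing_inv _ hSd, Matrix.mul_one, nonsing_inv_mul _ hSd]
  · change G = G * S⁻¹ * S
    rw [Matrix.mul_assoc, nonsing_inv_mul _ hSd, Matrix.mul_one]

theorem continuous_dotProduct_tensorPower_mulVec (T : (Fin n → Fin d) → ℝ) :
    Continuous fun G : Matrix (Fin d) (Fin d) ℝ => T ⬝ᵥ (tensorPower n G *ᵥ T) := by
  simp only [dotProduct, mulVec]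
  have := continuous_tensorPower_apply (d := d) n
  fun_prop

theorem dotProduct_tensorPower_mulVec_nonneg {T : (Fin n → Fin d) → ℝ}
    (hT : T ∈ orthInvariants n d) (G : Matrix (Fin d) (Fin d) ℝ) :
    0 ≤ T ⬝ᵥ (tensorPower n G *ᵥ T) := by
  have hunit : ∀ G : Matrix (Fin d) (Fin d) ℝ, IsUnit G → 0 ≤ T ⬝ᵥ (tensorPower n G *ᵥ T) := by
    intro G hG
    obtain ⟨O, S, hS, rfl⟩ := exists_orthogonal_mul_posSemidef hG
    have hO : (tensorPower n O.1)ᵀ *ᵥ T = T := by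
      conv_lhs => rw [← hT O]
      rw [mulVec_mulVec, ← tensorPower_transpose, ← tensorPower_mul]
      have h : O.1ᵀ * O.1 = 1 := (mem_orthogonalGroup_iff' _ _).1 O.2
      rw [h, tensorPower_one, one_mulVec]
    rw [tensorPower_mul, ← mulVec_mulVec, dotProduct_mulVec, ← mulVec_transpose, hO]
    exact dotProduct_tensorPower_mulVec_nonneg_of_posSemidef hS T
  have hcont : Continuous fun t : ℝ => T ⬝ᵥ (tensorPower n (G + scalar (Fin d) t) *ᵥ T) :=
    (continuous_dotProduct_tensorPower_mulVec T).comp (by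
      have : Continuous fun t : ℝ => (scalar (Fin d) t : Matrix (Fin d) (Fin d) ℝ) := by
        simp only [scalar_apply]
        fun_prop
      fun_prop)
  have hlim := (hcont.tendsto 0).mono_left (nhdsWithin_le_nhds (s := {0}ᶜ))
  simp only [map_zero, add_zero] at hlim
  refine ge_of_tendsto hlim ?_
  have hfin : {t : ℝ | (-G).charpoly.IsRoot t}.Finite :=
    Polynomial.finite_setOfPred_isRoot (charpoly_monic _).ne_zero
  have hcof := (hfin.subset (Set.sdiff_subset (t := {0}))).isClosed.isOpen_compl.mem_nhds
    (x := (0 : ℝ)) (by simp)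
  filter_upwards [nhdsWithin_le_nhds hcof, self_mem_nhdsWithin] with t ht ht0
  refine hunit _ ((isUnit_iff_isUnit_det _).2 (isUnit_iff_ne_zero.2 fun h => ht ⟨?_, ht0⟩))
  rw [Set.mem_ofPred_eq, Polynomial.IsRoot, eval_charpoly, sub_neg_eq_add, add_comm, h]

end Nonneg

section GaussianMoments

open ProbabilityTheory

theorem integrable_pow_gaussianReal (p : ℕ) :
    Integrable (fun x : ℝ => x ^ p) (gaussianReal 0 1) := by
  have h := (memLp_id_gaussianReal (μ := 0) (v := 1) p).integrable_norm_pow'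
  refine (integrable_norm_iff (by fun_prop)).1 (by simpa [norm_pow] using h)

theorem integral_pow_gaussianReal_add_two (p : ℕ) :
    ∫ x, x ^ (p + 2) ∂(gaussianReal 0 1) = (p + 1) * ∫ x, x ^ p ∂(gaussianReal 0 1) := by
  have hint (q : ℕ) : Integrable fun x : ℝ => gaussianPDFReal 0 1 x * x ^ q := by
    have h := integrable_pow_gaussianReal q
    rw [gaussianReal_of_var_ne_zero _ one_ne_zero, integrable_withDensity_iff_integrable_smul'
      (measurable_gaussianPDF _ _) (by simp [gaussianPDF_lt_top])] at h
    simpa using h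
  have hderiv (x : ℝ) : HasDerivAt (fun x => -gaussianPDFReal 0 1 x)
      (x * gaussianPDFReal 0 1 x) x := by
    simp only [gaussianPDFReal_def]
    have h : HasDerivAt (fun x : ℝ => -(x - 0) ^ 2 / (2 * ((1 : NNReal) : ℝ))) (-x) x := by
      have := (((hasDerivAt_id x).sub_const 0).pow 2).neg.div_const (2 * ((1 : NNReal) : ℝ))
      refine this.congr_deriv ?_
      norm_num
      ring
    exact (h.exp.const_mul (√(2 * Real.pi * ((1 : NNReal) : ℝ)))⁻¹).neg.congr_deriv (by ring)
  have key := integral_mul_deriv_eq_deriv_mul_of_integrable (A := ℝ)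
    (u := fun x => x ^ (p + 1)) (u' := fun x => ((p + 1 : ℕ) : ℝ) * x ^ p)
    (v := fun x => -gaussianPDFReal 0 1 x) (v' := fun x => x * gaussianPDFReal 0 1 x)
    (fun x _ => by simpa using hasDerivAt_pow (p + 1) x) (fun x _ => hderiv x)
    ((hint (p + 2)).congr (.of_forall fun x => by simp only [Pi.mul_apply]; ring))
    (((hint p).const_mul (-(p + 1))).congr
      (.of_forall fun x => by simp only [Pi.mul_apply]; push_cast; ring))
    ((hint (p + 1)).neg.congr (.of_forall fun x => by
      simp only [Pi.mul_apply, Pi.neg_apply]; ring))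
  rw [integral_gaussianReal_eq_integral_smul one_ne_zero,
    integral_gaussianReal_eq_integral_smul one_ne_zero, ← integral_const_mul]
  rw [← integral_neg] at key
  calc _ = ∫ x, x ^ (p + 1) * (x * gaussianPDFReal 0 1 x) :=
        integral_congr_ae (.of_forall fun x => by simp only [smul_eq_mul]; ring)
    _ = _ := key
    _ = _ := integral_congr_ae (.of_forall fun x => by simp only [smul_eq_mul]; push_cast; ring)

theorem integral_pow_one_gaussianReal : ∫ x, x ^ 1 ∂(gaussianReal 0 1) = 0 := by
  simp [integral_id_gaussianReal]

instance isOpenPosMeasure_gaussianReal : (gaussianReal 0 1).IsOpenPosMeasure :=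
  (gaussianReal_absolutelyContinuous' 0 one_ne_zero).isOpenPosMeasure

/-- The law of a matrix with independent standard Gaussian entries. -/
noncomputable def gaussianMatrix (d : ℕ) : Measure (Fin d × Fin d → ℝ) :=
  Measure.pi fun _ => gaussianReal 0 1

instance (d : ℕ) : (gaussianMatrix d).IsOpenPosMeasure := by
  unfold gaussianMatrix; infer_instance

theorem prod_comp_eq_prod_pow_card {ι κ : Type*} [Fintype κ] [DecidableEq κ] (K : Finset ι)
    (x : ι → κ) (w : κ → ℝ) :
    ∏ k ∈ K, w (x k) = ∏ c, w c ^ (K.filter fun k => x k = c).card := by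
  simp only [← Finset.prod_fiberwise' K x w, Finset.prod_const]

theorem integrable_prod_gaussianMatrix {d : ℕ} {ι : Type*} [Fintype ι] (x : ι → Fin d × Fin d) :
    Integrable (fun w : Fin d × Fin d → ℝ => ∏ k, w (x k)) (gaussianMatrix d) := by
  simp only [prod_comp_eq_prod_pow_card]
  exact Integrable.fintype_prod (f := fun c (t : ℝ) => t ^ (Finset.univ.filter
    fun k => x k = c).card) fun c => integrable_pow_gaussianReal _

theorem integral_prod_gaussianMatrix {d : ℕ} {ι : Type*} [Fintype ι] (x : ι → Fin d × Fin d) :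
    ∫ w, ∏ k, w (x k) ∂(gaussianMatrix d) =
      ∏ c, ∫ t, t ^ (Finset.univ.filter fun k => x k = c).card ∂(gaussianReal 0 1) := by
  simp only [prod_comp_eq_prod_pow_card]
  exact integral_fintype_prod_eq_prod (fun c (t : ℝ) => t ^ (Finset.univ.filter
    fun k => x k = c).card)

end GaussianMoments

section Wick

variable {ι κ : Type*} [DecidableEq ι] [Fintype κ] [DecidableEq κ]

/-- Wick's recursion for products of numbers satisfying the Gaussian moment recursion. -/
theorem prod_moment_insert {M : ℕ → ℝ} (hM1 : M 1 = 0) (hM : ∀ p : ℕ, M (p + 2) = (p + 1) * M p)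
    {K : Finset ι} {a : ι} (ha : a ∉ K) (x : ι → κ) :
    ∏ c, M ((insert a K).filter fun k => x k = c).card =
      ∑ l ∈ K, if x a = x l then ∏ c, M ((K.erase l).filter fun k => x k = c).card else 0 := by
  set R := ∏ c ∈ Finset.univ.erase (x a), M (K.filter fun k => x k = c).card
  set N := (K.filter fun k => x k = x a).card with hN
  have hleft : ∏ c, M ((insert a K).filter fun k => x k = c).card = M (N + 1) * R := by
    rw [← Finset.mul_prod_erase _ _ (Finset.mem_univ (x a))]
    congr 1
    · rw [Finset.filter_insert, if_pos rfl, Finset.card_insert_of_notMem (by simp [ha])]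
    · refine Finset.prod_congr rfl fun c hc => ?_
      rw [Finset.filter_insert, if_neg (Finset.ne_of_mem_erase hc).symm]
  have hright (l : ι) (hl : l ∈ K.filter fun k => x k = x a) :
      ∏ c, M ((K.erase l).filter fun k => x k = c).card = M (N - 1) * R := by
    obtain ⟨hlK, hlx⟩ := Finset.mem_filter.1 hl
    rw [← Finset.mul_prod_erase _ _ (Finset.mem_univ (x a))]
    congr 1
    · rw [Finset.filter_erase, Finset.card_erase_of_mem hl]
    · refine Finset.prod_congr rfl fun c hc => ?_
      rw [Finset.filter_erase, Finset.erase_eq_of_notMem]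
      simp only [Finset.mem_filter, not_and]
      intro _ h
      exact Finset.ne_of_mem_erase hc (h.symm.trans hlx)
  rw [hleft, ← Finset.sum_filter]
  simp only [eq_comm (a := x a)]
  rw [Finset.sum_congr rfl hright, Finset.sum_const, ← hN, nsmul_eq_mul]
  rcases N with _ | p
  · simp [hM1]
  · rw [hM]
    rw [Nat.cast_add, Nat.cast_one, add_tsub_cancel_right, mul_assoc]

/-- The indicator of the index functions that are invariant under `m`. -/
def matchingIndicator {d n : ℕ} (m : Equiv.Perm (Fin n)) : (Fin n → Fin d) → ℝ :=
  fun i => if i ∘ ⇑m = i then 1 else 0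

/-- The span of the indicators of the involutions moving exactly the points of `K`. -/
def partialMatchingSpan (d : ℕ) {n : ℕ} (K : Finset (Fin n)) :
    Submodule ℝ ((Fin n → Fin d) → ℝ) :=
  Submodule.span ℝ (matchingIndicator '' {m | (∀ x, m (m x) = x) ∧ ∀ x, m x ≠ x ↔ x ∈ K})

variable {d n : ℕ}

theorem indicator_mul_matchingIndicator {m : Equiv.Perm (Fin n)} {a l : Fin n}
    (hl : m l = l) (i : Fin n → Fin d) :
    (if i a = i l then matchingIndicator m i else 0) =
      matchingIndicator (Equiv.swap a l * m) i := by
  unfold matchingIndicator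
  rw [← ite_and]
  congr 1
  rw [eq_iff_iff]
  simp only [funext_iff, Function.comp_apply, Equiv.Perm.mul_apply]
  constructor
  · rintro ⟨h, hm⟩ x
    rw [← hm x]
    rcases eq_or_ne (m x) a with hx | hx
    · rw [hx, Equiv.swap_apply_left, h]
    rcases eq_or_ne (m x) l with hx' | hx'
    · rw [hx', Equiv.swap_apply_right, h]
    rw [Equiv.swap_apply_of_ne_of_ne hx hx']
  · intro h
    have hal : i a = i l := by simpa [hl] using h l
    refine ⟨hal, fun x => ?_⟩
    rw [← h x]
    rcases eq_or_ne (m x) a with hx | hx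
    · rw [hx, Equiv.swap_apply_left, hal]
    rcases eq_or_ne (m x) l with hx' | hx'
    · rw [hx', Equiv.swap_apply_right, hal]
    rw [Equiv.swap_apply_of_ne_of_ne hx hx']

theorem indicator_mul_mem_partialMatchingSpan {K : Finset (Fin n)} {a l : Fin n} (ha : a ∉ K)
    (hl : l ∈ K) {f : (Fin n → Fin d) → ℝ} (hf : f ∈ partialMatchingSpan d (K.erase l)) :
    (fun i => if i a = i l then f i else 0) ∈ partialMatchingSpan d (insert a K) := by
  have hal : a ≠ l := fun h => ha (h ▸ hl)
  induction hf using Submodule.span_induction with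
  | mem f hf =>
    obtain ⟨m, ⟨hinv, hsupp⟩, rfl⟩ := hf
    have hma : m a = a := by
      by_contra h
      exact ha (Finset.mem_of_mem_erase ((hsupp a).1 h))
    have hml : m l = l := by
      by_contra h
      exact Finset.notMem_erase _ _ ((hsupp l).1 h)
    have hcomm : Equiv.swap a l * m = m * Equiv.swap a l := by
      conv_rhs => rw [Equiv.mul_swap_eq_swap_mul, hma, hml]
    simp only [indicator_mul_matchingIndicator hml]
    refine Submodule.subset_span ⟨_, ⟨fun x => ?_, fun x => ?_⟩, rfl⟩
    · have h : (Equiv.swap a l * m) * (Equiv.swap a l * m) = 1 := by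
        nth_rewrite 2 [hcomm]
        rw [mul_assoc, ← mul_assoc m m, show m * m = 1 from Equiv.ext hinv, one_mul,
          Equiv.swap_mul_self]
      exact congrArg (fun σ : Equiv.Perm (Fin n) => σ x) h
    · rw [Equiv.Perm.mul_apply, Finset.mem_insert]
      rcases eq_or_ne x a with rfl | hxa
      · simp [hma, hal.symm]
      rcases eq_or_ne x l with rfl | hxl
      · simp [hml, hal, hl]
      have h1 : m x ≠ a := fun h => hxa (m.injective (h.trans hma.symm))
      have h2 : m x ≠ l := fun h => hxl (m.injective (h.trans hml.symm))
      rw [Equiv.swap_apply_of_ne_of_ne h1 h2, hsupp x]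
      simp [hxa, hxl]
  | zero =>
    convert Submodule.zero_mem (partialMatchingSpan d (insert a K)) using 1
    ext i
    simp
  | add f g _ _ hf hg =>
    convert Submodule.add_mem _ hf hg using 1
    ext i
    by_cases h : i a = i l <;> simp [h]
  | smul c f _ hf =>
    convert Submodule.smul_mem _ c hf using 1
    ext i
    by_cases h : i a = i l <;> simp [h]

theorem prod_moment_mem_partialMatchingSpan {M : ℕ → ℝ} (hM1 : M 1 = 0)
    (hM : ∀ p : ℕ, M (p + 2) = (p + 1) * M p) (j : Fin n → Fin d) (K : Finset (Fin n)) :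
    (fun i : Fin n → Fin d =>
      ∏ c : Fin d × Fin d, M (K.filter fun k => (i k, j k) = c).card) ∈
        partialMatchingSpan d K := by
  induction K using Finset.strongInduction with
  | H K ih =>
  rcases K.eq_empty_or_nonempty with rfl | ⟨a, haK⟩
  · have h : matchingIndicator (1 : Equiv.Perm (Fin n)) ∈ partialMatchingSpan d ∅ :=
      Submodule.subset_span ⟨1, by simp, rfl⟩
    convert Submodule.smul_mem _ (∏ _c : Fin d × Fin d, M 0) h using 1
    ext i
    simp [matchingIndicator]
  · obtain ⟨K, ha, rfl⟩ : ∃ K', a ∉ K' ∧ insert a K' = K :=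
      ⟨K.erase a, Finset.notMem_erase _ _, Finset.insert_erase haK⟩
    simp only [prod_moment_insert hM1 hM ha]
    have hsum : (fun i : Fin n → Fin d => ∑ l ∈ K, if (i a, j a) = (i l, j l) then
        ∏ c : Fin d × Fin d, M ((K.erase l).filter fun k => (i k, j k) = c).card else 0) =
        ∑ l ∈ K, fun i : Fin n → Fin d => if (i a, j a) = (i l, j l) then
        ∏ c : Fin d × Fin d, M ((K.erase l).filter fun k => (i k, j k) = c).card else 0 := by
      ext i
      simp
    rw [hsum]
    refine Submodule.sum_mem _ fun l hl => ?_
    by_cases hj : j a = j l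
    · simp only [Prod.mk.injEq, hj, and_true]
      exact indicator_mul_mem_partialMatchingSpan ha hl
        (ih _ ((Finset.erase_subset l K).trans_ssubset (Finset.ssubset_insert ha)))
    · simp only [Prod.mk.injEq, hj, and_false, if_false]
      exact Submodule.zero_mem _

theorem partialMatchingSpan_univ :
    partialMatchingSpan d (Finset.univ : Finset (Fin n)) =
      Submodule.span ℝ (Set.range (rho d n)) := by
  unfold partialMatchingSpan
  congr 1
  ext f
  constructor
  · rintro ⟨m, ⟨h1, h2⟩, rfl⟩
    exact ⟨⟨m, h1, fun x => (h2 x).2 (Finset.mem_univ x)⟩, rfl⟩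
  · rintro ⟨m, rfl⟩
    exact ⟨m.1, ⟨m.2.1, fun x => by simp [m.2.2 x]⟩, rfl⟩

end Wick

section GaussianAverage

open Matrix

variable {d n : ℕ}

/-- The matrix of the Gaussian average of `G^{⊗n}` in the standard tensor basis. -/
noncomputable def gaussianAverage (d n : ℕ) : Matrix (Fin n → Fin d) (Fin n → Fin d) ℝ :=
  Matrix.of fun i j => ∫ w, tensorPower n (Matrix.of fun a b => w (a, b)) i j ∂(gaussianMatrix d)

theorem integrable_tensorPower_gaussianMatrix (i j : Fin n → Fin d) :
    Integrable (fun w => tensorPower n (Matrix.of fun a b => w (a, b)) i j) (gaussianMatrix d) :=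
  integrable_prod_gaussianMatrix fun k => (i k, j k)

theorem gaussianAverage_mulVec_mem_span (T : (Fin n → Fin d) → ℝ) :
    gaussianAverage d n *ᵥ T ∈ Submodule.span ℝ (Set.range (rho d n)) := by
  rw [mulVec_eq_sum]
  refine Submodule.sum_mem _ fun j _ => ?_
  rw [op_smul_eq_smul]
  refine Submodule.smul_mem _ _ ?_
  rw [← partialMatchingSpan_univ]
  convert prod_moment_mem_partialMatchingSpan
    (M := fun p => ∫ x, x ^ p ∂(ProbabilityTheory.gaussianReal 0 1))
    integral_pow_one_gaussianReal integral_pow_gaussianReal_add_two j Finset.univ using 1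
  ext i
  exact integral_prod_gaussianMatrix fun k => (i k, j k)

theorem dotProduct_tensorPower_mulVec_eq_sum (T : (Fin n → Fin d) → ℝ)
    (G : Matrix (Fin d) (Fin d) ℝ) :
    T ⬝ᵥ (tensorPower n G *ᵥ T) = ∑ i, ∑ j, T i * (tensorPower n G i j * T j) := by
  simp only [dotProduct, mulVec, Finset.mul_sum]

theorem integrable_dotProduct_tensorPower_mulVec (T : (Fin n → Fin d) → ℝ) :
    Integrable (fun w => T ⬝ᵥ (tensorPower n (Matrix.of fun a b => w (a, b)) *ᵥ T))
      (gaussianMatrix d) := by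
  simp only [dotProduct_tensorPower_mulVec_eq_sum]
  exact integrable_finsetSum _ fun i _ => integrable_finsetSum _ fun j _ =>
    ((integrable_tensorPower_gaussianMatrix i j).mul_const _).const_mul _

theorem dotProduct_gaussianAverage_mulVec (T : (Fin n → Fin d) → ℝ) :
    T ⬝ᵥ (gaussianAverage d n *ᵥ T) =
      ∫ w, T ⬝ᵥ (tensorPower n (Matrix.of fun a b => w (a, b)) *ᵥ T) ∂(gaussianMatrix d) := by
  have hint (i j : Fin n → Fin d) := ((integrable_tensorPower_gaussianMatrix i j).mul_const
    (T j)).const_mul (T i)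
  simp only [dotProduct_tensorPower_mulVec_eq_sum]
  rw [integral_finsetSum _ fun i _ => integrable_finsetSum _ fun j _ => hint i j]
  simp only [dotProduct, mulVec, Finset.mul_sum]
  refine Finset.sum_congr rfl fun i _ => ?_
  rw [integral_finsetSum _ fun j _ => hint i j]
  refine Finset.sum_congr rfl fun j _ => ?_
  rw [integral_const_mul, integral_mul_const]
  rfl

theorem eq_zero_of_gaussianAverage_mulVec_eq_zero {T : (Fin n → Fin d) → ℝ}
    (hT : T ∈ orthInvariants n d) (h : gaussianAverage d n *ᵥ T = 0) : T = 0 := by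
  have hint := dotProduct_gaussianAverage_mulVec T
  rw [h, dotProduct_zero] at hint
  have hcont : Continuous fun w : Fin d × Fin d → ℝ =>
      T ⬝ᵥ (tensorPower n (Matrix.of fun a b => w (a, b)) *ᵥ T) :=
    (continuous_dotProduct_tensorPower_mulVec T).comp
      (continuous_matrix fun a b => continuous_apply (a, b))
  have hae := (integral_eq_zero_iff_of_nonneg
    (fun w => dotProduct_tensorPower_mulVec_nonneg hT _)
    (integrable_dotProduct_tensorPower_mulVec T)).1 hint.symm
  have hzero := congrFun (hcont.ae_eq_iff_eq _ continuous_zero |>.1 hae)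
    fun c => (1 : Matrix (Fin d) (Fin d) ℝ) c.1 c.2
  have hone : (Matrix.of fun a b => (1 : Matrix (Fin d) (Fin d) ℝ) a b) = 1 := rfl
  simp only [hone, tensorPower_one, one_mulVec] at hzero
  exact dotProduct_self_eq_zero.1 hzero

/-- The smaller endpoints of the pairs of a matching. -/
abbrev Matchings.Lower (m : Matchings n) : Type := {k : Fin n // k < m.1 k}

theorem Matchings.lt_or_lt (m : Matchings n) (k : Fin n) : k < m.1 k ∨ m.1 k < m.1 (m.1 k) := by
  rw [m.2.1 k]
  exact (m.2.2 k).symm.lt_or_gt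

/-- The smaller endpoint of the pair containing a given point. -/
def Matchings.lower (m : Matchings n) (k : Fin n) : m.Lower :=
  if h : k < m.1 k then ⟨k, h⟩ else ⟨m.1 k, (m.lt_or_lt k).resolve_left h⟩

theorem Matchings.lower_coe (m : Matchings n) (h : m.Lower) : m.lower h = h := dif_pos h.2

theorem Matchings.lower_apply_coe (m : Matchings n) (h : m.Lower) : m.lower (m.1 h) = h := by
  have hlt : ¬ m.1 h.1 < m.1 (m.1 h.1) := by
    rw [m.2.1]
    exact h.2.le.not_gt
  rw [Matchings.lower, dif_neg hlt]
  exact Subtype.ext (m.2.1 _)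

theorem Matchings.lower_apply (m : Matchings n) (k : Fin n) : m.lower (m.1 k) = m.lower k := by
  by_cases h : k < m.1 k
  · have h' := m.lower_apply_coe ⟨k, h⟩
    exact h'.trans (m.lower_coe ⟨k, h⟩).symm
  · have h' := m.lower_apply_coe ⟨m.1 k, (m.lt_or_lt k).resolve_left h⟩
    simp only [m.2.1 k] at h'
    rw [h', ← m.lower_coe ⟨m.1 k, _⟩]

theorem Matchings.comp_eq_iff {α : Type*} (m : Matchings n) (i : Fin n → α) :
    i ∘ ⇑m.1 = i ↔ ∀ h : m.Lower, i h = i (m.1 h) := by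
  refine ⟨fun hi h => (congrFun hi h.1).symm, fun hi => funext fun k => ?_⟩
  rcases m.lt_or_lt k with h | h
  · exact (hi ⟨k, h⟩).symm
  · simpa [m.2.1 k] using hi ⟨_, h⟩

theorem Matchings.prod_eq (m : Matchings n) (F : Fin n → ℝ) :
    ∏ k, F k = ∏ h : m.Lower, F h * F (m.1 h) := by
  rw [Finset.prod_mul_distrib,
    ← Finset.prod_filter_mul_prod_filter_not Finset.univ (fun k => k < m.1 k) F]
  congr 1
  · exact Finset.prod_subtype _ (by simp) F
  · rw [← Finset.prod_subtype (Finset.univ.filter fun k => k < m.1 k) (by simp)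
      fun k => F (m.1 k)]
    refine (Finset.prod_equiv m.1 (fun k => ?_) fun k _ => rfl).symm
    simp only [Finset.mem_filter, Finset.mem_univ, true_and, m.2.1 k, not_lt]
    exact ⟨le_of_lt, fun h => lt_of_le_of_ne h (m.2.2 k).symm⟩

theorem Matchings.sum_filter_comp_eq (m : Matchings n) (F : (Fin n → Fin d) → ℝ) :
    ∑ j with j ∘ ⇑m.1 = j, F j = ∑ j : m.Lower → Fin d, F (j ∘ m.lower) := by
  refine Finset.sum_nbij' (fun j h => j h.1) (fun j => j ∘ m.lower) (by simp) ?_ ?_ ?_ ?_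
  · intro j _
    simp only [Finset.mem_filter, Finset.mem_univ, true_and]
    ext k
    simp [m.lower_apply]
  · intro j hj
    have hj' := (Finset.mem_filter.1 hj).2
    ext k : 1
    unfold Function.comp Matchings.lower
    split_ifs
    · rfl
    · exact congrFun hj' k
  · intro j _
    ext h : 1
    simp [m.lower_coe]
  · intro j hj
    have hj' := (Finset.mem_filter.1 hj).2
    congr 1
    ext k : 1
    unfold Function.comp Matchings.lower
    split_ifs
    · rfl
    · exact (congrFun hj' k).symm

theorem tensorPower_mulVec_rho {g : Matrix (Fin d) (Fin d) ℝ} (hg : g * gᵀ = 1)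
    (m : Matchings n) : tensorPower n g *ᵥ rho d n m = rho d n m := by
  ext i
  calc (tensorPower n g *ᵥ rho d n m) i = ∑ j with j ∘ ⇑m.1 = j, tensorPower n g i j := by
        simp only [mulVec, dotProduct, rho, mul_ite, mul_one, mul_zero, Finset.sum_filter]
    _ = ∑ j : m.Lower → Fin d, ∏ h : m.Lower, g (i h) (j h) * g (i (m.1 h)) (j h) := by
        rw [m.sum_filter_comp_eq]
        simp only [tensorPower_apply, m.prod_eq, Function.comp_apply, m.lower_coe,
          m.lower_apply_coe]
    _ = ∏ h : m.Lower, (g * gᵀ) (i h) (i (m.1 h)) := by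
        simp only [mul_apply, transpose_apply, Finset.prod_univ_sum, Fintype.piFinset_univ]
    _ = rho d n m i := by
        simp only [hg, one_apply, Finset.prod_ite_zero, rho, m.comp_eq_iff]
        simp

theorem span_rho_le_orthInvariants :
    Submodule.span ℝ (Set.range (rho d n)) ≤ orthInvariants n d := by
  rw [Submodule.span_le]
  rintro _ ⟨m, rfl⟩ g
  exact tensorPower_mulVec_rho ((mem_orthogonalGroup_iff _ _).1 g.2) m

/-- The first fundamental theorem of invariant theory for the orthogonal group. -/
theorem orthInvariants_eq_span_rho :
    orthInvariants n d = Submodule.span ℝ (Set.range (rho d n)) := by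
  refine (Submodule.eq_of_le_of_finrank_le span_rho_le_orthInvariants ?_).symm
  let φ : orthInvariants n d →ₗ[ℝ] Submodule.span ℝ (Set.range (rho d n)) :=
    ((gaussianAverage d n).mulVecLin.comp (orthInvariants n d).subtype).codRestrict _
      fun T => gaussianAverage_mulVec_mem_span T.1
  refine LinearMap.finrank_le_finrank_of_injective (f := φ) ?_
  rw [injective_iff_map_eq_zero]
  intro T hT
  exact Subtype.ext (eq_zero_of_gaussianAverage_mulVec_eq_zero T.2 (congrArg Subtype.val hT))

end GaussianAverage

section HaarAverage

open Matrix

variable {d n : ℕ}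

instance (d : ℕ) : BorelSpace (OrthGroup d) := ⟨rfl⟩

theorem integrable_tensorPower_orthGroup (μ : Measure (OrthGroup d)) [IsFiniteMeasure μ]
    (i j : Fin n → Fin d) : Integrable (fun g : OrthGroup d => tensorPower n g.1 i j) μ := by
  refine Integrable.of_bound (C := 1)
    ((continuous_tensorPower_apply n i j).comp continuous_subtype_val).aestronglyMeasurable
    (.of_forall fun g => ?_)
  rw [tensorPower_apply, norm_prod]
  exact Finset.prod_le_one (fun _ _ => norm_nonneg _)
    fun k _ => entry_norm_bound_of_unitary (𝕜 := ℝ) g.2 _ _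

variable {μ : Measure (OrthGroup d)} [IsProbabilityMeasure μ]
  {P : Matrix (Fin n → Fin d) (Fin n → Fin d) ℝ}

theorem tensorPower_mul_average [μ.IsHaarMeasure]
    (hP : ∀ i j, P i j = ∫ g, tensorPower n g.1 i j ∂μ)
    (h : OrthGroup d) : tensorPower n h.1 * P = P := by
  ext i j
  rw [mul_apply]
  simp only [hP]
  rw [← integral_mul_left_eq_self (fun g : OrthGroup d => tensorPower n g.1 i j) h]
  have hmul (g : OrthGroup d) : tensorPower n (h * g).1 i j =
      ∑ k, tensorPower n h.1 i k * tensorPower n g.1 k j := by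
    rw [← mul_apply, ← tensorPower_mul]
    rfl
  simp only [hmul]
  rw [integral_finsetSum _ fun k _ => (integrable_tensorPower_orthGroup μ k j).const_mul _]
  simp only [integral_const_mul]

theorem average_mulVec_mem_orthInvariants [μ.IsHaarMeasure]
    (hP : ∀ i j, P i j = ∫ g, tensorPower n g.1 i j ∂μ)
    (T : (Fin n → Fin d) → ℝ) : P *ᵥ T ∈ orthInvariants n d := fun g => by
  rw [mulVec_mulVec, tensorPower_mul_average hP]

theorem average_mulVec_of_mem_orthInvariants
    (hP : ∀ i j, P i j = ∫ g, tensorPower n g.1 i j ∂μ) {T : (Fin n → Fin d) → ℝ}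
    (hT : T ∈ orthInvariants n d) : P *ᵥ T = T := by
  ext i
  have hgT (g : OrthGroup d) : ∑ j, tensorPower n g.1 i j * T j = T i := congrFun (hT g) i
  calc (P *ᵥ T) i = ∑ j, (∫ g, tensorPower n g.1 i j ∂μ) * T j := by
        simp only [mulVec, dotProduct, hP]
    _ = ∫ g : OrthGroup d, ∑ j, tensorPower n g.1 i j * T j ∂μ := by
        rw [integral_finsetSum _ fun j _ =>
          (integrable_tensorPower_orthGroup μ i j).mul_const _]
        simp only [integral_mul_const]
    _ = T i := by simp [hgT]

theorem average_mul_self [μ.IsHaarMeasure]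
    (hP : ∀ i j, P i j = ∫ g, tensorPower n g.1 i j ∂μ) : P * P = P :=
  ext_of_mulVec_single fun j => by
    rw [← mulVec_mulVec]
    exact average_mulVec_of_mem_orthInvariants hP (average_mulVec_mem_orthInvariants hP _)

theorem transpose_average_mul_self [μ.IsHaarMeasure]
    (hP : ∀ i j, P i j = ∫ g, tensorPower n g.1 i j ∂μ) :
    Pᵀ * P = P := by
  ext i j
  have hg (g : OrthGroup d) : ∑ k, tensorPower n g.1 k i * P k j = P i j :=
    congrFun (congrFun (tensorPower_mul_average hP (star g)) i) j
  calc (Pᵀ * P) i j = ∑ k, (∫ g, tensorPower n g.1 k i ∂μ) * P k j := by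
        simp only [mul_apply, transpose_apply, ← hP]
    _ = ∫ g : OrthGroup d, ∑ k, tensorPower n g.1 k i * P k j ∂μ := by
        rw [integral_finsetSum _ fun k _ =>
          (integrable_tensorPower_orthGroup μ k i).mul_const _]
        simp only [integral_mul_const]
    _ = P i j := by simp [hg]

theorem average_transpose [μ.IsHaarMeasure]
    (hP : ∀ i j, P i j = ∫ g, tensorPower n g.1 i j ∂μ) : Pᵀ = P := by
  have h := transpose_average_mul_self hP
  calc Pᵀ = (Pᵀ * P)ᵀ := by rw [h]
    _ = P := by rw [transpose_mul, transpose_transpose, h]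

theorem average_eq_zero_of_odd [μ.IsHaarMeasure]
    (hP : ∀ i j, P i j = ∫ g, tensorPower n g.1 i j ∂μ)
    (hn : Odd n) : P = 0 := by
  have h := tensorPower_mul_average hP (-1)
  have hneg : tensorPower n (-1 : OrthGroup d).1 = -1 := by
    change tensorPower n (-1 : Matrix (Fin d) (Fin d) ℝ) = -1
    rw [tensorPower_neg, hn.neg_one_pow, tensorPower_one, neg_one_smul]
  rw [hneg, neg_one_mul] at h
  ext i j
  exact neg_eq_self.1 (congrFun (congrFun h i) j)

theorem range_average [μ.IsHaarMeasure]
    (hP : ∀ i j, P i j = ∫ g, tensorPower n g.1 i j ∂μ) :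
    LinearMap.range P.mulVecLin = orthInvariants n d := by
  apply le_antisymm
  · rintro _ ⟨T, rfl⟩
    exact average_mulVec_mem_orthInvariants hP T
  · intro T hT
    exact ⟨T, average_mulVec_of_mem_orthInvariants hP hT⟩

end HaarAverage

theorem stmt2 (d n : ℕ) (hd : 0 < d) (hn : 0 < n)
    (μ : Measure (OrthGroup d)) [μ.IsHaarMeasure] [IsProbabilityMeasure μ]
    (P : Matrix (Fin n → Fin d) (Fin n → Fin d) ℝ)
    (hP : ∀ i j : Fin n → Fin d,
      P i j = ∫ g, (∏ k, ((g : Matrix (Fin d) (Fin d) ℝ) (i k) (j k))) ∂μ) :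
    P * P = P ∧ P.transpose = P ∧
      (Odd n → P = 0) ∧
      (Even n → LinearMap.range P.mulVecLin
        = Submodule.span ℝ (Set.range (rho d n))) :=
  ⟨average_mul_self hP, average_transpose hP, average_eq_zero_of_odd hP,
    fun _ => (range_average hP).trans orthInvariants_eq_span_rho⟩
end

section
/- Let k, d, n be positive integers with k ≤ d, and let W be a symmetric real matrix indexed by M(2n) satisfying G·W·G = G where G = G_n^{O(d)}. Then the 2n-th moment of the trace of the k×k upper-left corner of a Haar-distributed orthogonal matrix is ∫_{O(d)} (∑_{a=1}^{k} g_{aa})^{2n} dg = ∑_{𝔪,𝔫 ∈ M(2n)} W(𝔪,𝔫) · k^{loop(𝔪,𝔫)}. -/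
open MeasureTheory

instance (N : ℕ) : DecidableEq (Matchings N) := Subtype.instDecidableEq

/-- number of orbits (cycles together with fixed points) of a permutation of `Fin N`. -/
def cycleCount {N : ℕ} (σ : Equiv.Perm (Fin N)) : ℕ :=
  σ.cycleType.card + (Finset.univ.filter fun x => σ x = x).card

/-- `loop(𝔪,𝔫)`: half the number of orbits of `𝔪 ∘ 𝔫`. -/
def loopCount {N : ℕ} (m p : Matchings N) : ℕ := cycleCount (m.1 * p.1) / 2

/-- The orthogonal Gram matrix `G_n^{O(d)}`. -/
noncomputable def GramO (d n : ℕ) : Matrix (Matchings (2*n)) (Matchings (2*n)) ℝ :=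
  fun m p => (d : ℝ) ^ loopCount m p

/-- Invariance of a real tensor, indexed by `ι → Fin d`, under the diagonal action of `O(d)`. -/
def IsOrthInvariant {ι : Type} [Fintype ι] [DecidableEq ι] {d : ℕ} (T : (ι → Fin d) → ℝ) : Prop :=
  ∀ g ∈ Matrix.orthogonalGroup (Fin d) ℝ, ∀ I, ∑ J, (∏ x, g (I x) (J x)) * T J = T I

/-- The tensor attached to a permutation `m`: the indicator of the `m`-invariant multi-indices. -/
noncomputable def pairTensor {ι α : Type} (m : Equiv.Perm ι) (I : ι → α) : ℝ :=
  open Classical in if ∀ x, I (m x) = I x then 1 else 0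

/-- A tensor which is symmetric under `so(d)`, traceless, and supported on even weights is zero. -/
theorem tensor_eq_zero_of_traceless {ι : Type} [Fintype ι] [DecidableEq ι] [Nonempty ι] {d : ℕ}
    (T : (ι → Fin d) → ℝ)
    (hlie : ∀ a b I, ∑ x, (if I x = a then T (Function.update I x b) else 0) =
      ∑ x, if I x = b then T (Function.update I x a) else 0)
    (htr : ∀ I x y, x ≠ y → ∑ b, T (Function.update (Function.update I x b) y b) = 0)
    (heven : ∀ I, T I ≠ 0 → ∀ a, Even (Finset.univ.filter fun x => I x = a).card) :
    T = 0 := by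
  classical
  set D : Fin d → Fin d → (ι → Fin d) → ℝ :=
    fun a b I => ∑ x, (if I x = a then T (Function.update I x b) else 0) with hD
  have hsymm : ∀ a b I, D a b I = D b a I := hlie
  have hmove : ∀ a b x, ∑ I : ι → Fin d, D a b I * (if I x = b then T (Function.update I x a) else 0)
      = ∑ I : ι → Fin d, if I x = a then T I * D a b (Function.update I x b) else 0 := by
    intro a b x
    simp only [mul_ite, mul_zero]
    rw [← Finset.sum_filter, ← Finset.sum_filter]
    refine Finset.sum_bij' (fun I _ => Function.update I x a) (fun I _ => Function.update I x b)
      ?_ ?_ ?_ ?_ ?_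
    · intro I hI; simp
    · intro I hI; simp
    · intro I hI
      have : I x = b := by simpa using hI
      subst this; simp
    · intro I hI
      have : I x = a := by simpa using hI
      subst this; simp
    · intro I hI
      have : I x = b := by simpa using hI
      subst this; simp [mul_comm]
  have hcontr : ∀ I x, ∑ b, D (I x) b (Function.update I x b) = T I := by
    intro I x
    simp only [hD]
    rw [Finset.sum_comm, Finset.sum_eq_single x]
    · simp
    · intro y _ hyx
      simp only [Function.update_of_ne hyx]
      split_ifs
      · exact htr I x y hyx.symm
      · simp
    · simp
  have htotal : ∑ a, ∑ b, ∑ I, D a b I ^ 2 = ∑ I, (Fintype.card ι : ℝ) * T I ^ 2 := by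
    calc ∑ a, ∑ b, ∑ I, D a b I ^ 2
        = ∑ a, ∑ b, ∑ x, ∑ I, D a b I * (if I x = b then T (Function.update I x a) else 0) := by
          refine Finset.sum_congr rfl fun a _ => Finset.sum_congr rfl fun b _ => ?_
          rw [Finset.sum_comm]
          refine Finset.sum_congr rfl fun I _ => ?_
          rw [← Finset.mul_sum, sq]
          congr 1
          exact hsymm a b I
      _ = ∑ a, ∑ b, ∑ x, ∑ I : ι → Fin d,
            if I x = a then T I * D a b (Function.update I x b) else 0 := by
          simp only [hmove]
      _ = ∑ I : ι → Fin d, ∑ x, ∑ b, ∑ a,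
            if I x = a then T I * D a b (Function.update I x b) else 0 := by
          rw [Finset.sum_comm]
          simp_rw [Finset.sum_comm (s := (Finset.univ : Finset (Fin d)))
            (t := (Finset.univ : Finset ι))]
          simp_rw [Finset.sum_comm (s := (Finset.univ : Finset (Fin d)))
            (t := (Finset.univ : Finset (ι → Fin d)))]
          rw [Finset.sum_comm]
      _ = ∑ I, (Fintype.card ι : ℝ) * T I ^ 2 := by
          refine Finset.sum_congr rfl fun I _ => ?_
          simp only [Finset.sum_ite_eq, Finset.mem_univ, if_true, ← Finset.mul_sum, hcontr]
          simp only [Finset.sum_const, Finset.card_univ, nsmul_eq_mul]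
          ring
  have hdiag : ∀ I, 2 * (Fintype.card ι : ℝ) * T I ^ 2 ≤ ∑ a, D a a I ^ 2 := by
    intro I
    have hDa : ∀ a, D a a I = ((Finset.univ.filter fun x => I x = a).card : ℝ) * T I := by
      intro a
      simp only [hD]
      rw [← Finset.sum_filter, ← nsmul_eq_mul, ← Finset.sum_const]
      refine Finset.sum_congr rfl fun x hx => ?_
      have : I x = a := by simpa using hx
      subst this; simp
    by_cases hT : T I = 0
    · simp [hT]; positivity
    have hcard : (Fintype.card ι : ℝ) =
        ∑ a, ((Finset.univ.filter fun x => I x = a).card : ℝ) := by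
      rw [← Nat.cast_sum, ← Finset.card_eq_sum_card_fiberwise (fun _ _ => Finset.mem_univ _)]
      simp
    rw [hcard, Finset.mul_sum, Finset.sum_mul]
    refine Finset.sum_le_sum fun a _ => ?_
    rw [hDa, mul_pow]
    refine mul_le_mul_of_nonneg_right ?_ (sq_nonneg _)
    obtain ⟨c, hc⟩ := heven I hT a
    rw [hc]
    have : c ≤ c ^ 2 := Nat.le_self_pow two_ne_zero c
    have : (c : ℝ) ≤ (c : ℝ) ^ 2 := by exact_mod_cast this
    push_cast
    nlinarith
  have hle : ∑ I, 2 * (Fintype.card ι : ℝ) * T I ^ 2 ≤ ∑ I, (Fintype.card ι : ℝ) * T I ^ 2 := by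
    rw [← htotal]
    calc ∑ I, 2 * (Fintype.card ι : ℝ) * T I ^ 2 ≤ ∑ I, ∑ a, D a a I ^ 2 :=
          Finset.sum_le_sum fun I _ => hdiag I
      _ = ∑ a, ∑ I, D a a I ^ 2 := Finset.sum_comm
      _ ≤ _ := by
          refine Finset.sum_le_sum fun a _ => ?_
          exact Finset.single_le_sum (f := fun b => ∑ I, D a b I ^ 2)
            (fun b _ => Finset.sum_nonneg fun I _ => sq_nonneg _) (Finset.mem_univ a)
  have hpos : (0 : ℝ) < Fintype.card ι := by exact_mod_cast Fintype.card_pos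
  have hsum : ∑ I, T I ^ 2 = 0 := by
    rw [← Finset.mul_sum, ← Finset.mul_sum] at hle
    have : 0 ≤ ∑ I, T I ^ 2 := Finset.sum_nonneg fun I _ => sq_nonneg _
    nlinarith
  funext I
  have := (Finset.sum_eq_zero_iff_of_nonneg fun I _ => sq_nonneg (T I)).1 hsum I (Finset.mem_univ I)
  simpa using this

open Matrix in
theorem exp_smul_mem_orthogonalGroup {d : ℕ} (X : Matrix (Fin d) (Fin d) ℝ) (hX : Xᵀ = -X)
    (t : ℝ) : NormedSpace.exp (t • X) ∈ Matrix.orthogonalGroup (Fin d) ℝ := by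
  rw [Matrix.mem_orthogonalGroup_iff, ← Matrix.exp_transpose, Matrix.transpose_smul, hX,
    smul_neg, Matrix.exp_neg]
  exact Matrix.mul_nonsing_inv _ ((Matrix.isUnit_iff_isUnit_det _).1 (Matrix.isUnit_exp _))

theorem hasDerivAt_exp_smul_apply {d : ℕ} (X : Matrix (Fin d) (Fin d) ℝ) (i j : Fin d) :
    HasDerivAt (fun t : ℝ => NormedSpace.exp (t • X) i j) (X i j) 0 := by
  let : NormedRing (Matrix (Fin d) (Fin d) ℝ) := Matrix.linftyOpNormedRing
  let : NormedAlgebra ℝ (Matrix (Fin d) (Fin d) ℝ) := Matrix.linftyOpNormedAlgebra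
  have h := hasDerivAt_exp_smul_const (𝕂 := ℝ) X (0 : ℝ)
  have h2 := ((LinearMap.toContinuousLinearMap
    (Matrix.entryLinearMap ℝ ℝ i j)).hasFDerivAt).comp_hasDerivAt (0 : ℝ) h
  refine h2.congr_deriv ?_
  rw [zero_smul, NormedSpace.exp_zero, one_mul]
  rfl

/-- The infinitesimal form of orthogonal invariance. -/
theorem IsOrthInvariant.sum_skew {ι : Type} [Fintype ι] [DecidableEq ι] {d : ℕ}
    {T : (ι → Fin d) → ℝ} (hT : IsOrthInvariant T) (X : Matrix (Fin d) (Fin d) ℝ)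
    (hX : X.transpose = -X) (I : ι → Fin d) :
    ∑ x, ∑ b, X (I x) b * T (Function.update I x b) = 0 := by
  have hder : HasDerivAt
      (fun t : ℝ => ∑ J : ι → Fin d, (∏ x, NormedSpace.exp (t • X) (I x) (J x)) * T J)
      (∑ J : ι → Fin d, (∑ x, (∏ y ∈ Finset.univ.erase x,
        NormedSpace.exp ((0 : ℝ) • X) (I y) (J y)) • X (I x) (J x)) * T J) 0 :=
    HasDerivAt.fun_sum fun J _ => (HasDerivAt.fun_finsetProd fun x _ =>
      hasDerivAt_exp_smul_apply X (I x) (J x)).mul_const (T J)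
  have hconst : (fun t : ℝ => ∑ J : ι → Fin d,
      (∏ x, NormedSpace.exp (t • X) (I x) (J x)) * T J) = fun _ => T I := by
    funext t
    exact hT _ (exp_smul_mem_orthogonalGroup X hX t) I
  rw [hconst] at hder
  have h0 := hder.unique (hasDerivAt_const (0 : ℝ) (T I))
  refine Eq.trans ?_ h0
  symm
  simp_rw [Finset.sum_mul]
  rw [Finset.sum_comm]
  refine Finset.sum_congr rfl fun x _ => ?_
  have hprod : ∀ J : ι → Fin d, (∏ y ∈ Finset.univ.erase x,
      NormedSpace.exp ((0 : ℝ) • X) (I y) (J y)) = if J = Function.update I x (J x) then 1 else 0 := by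
    intro J
    simp only [zero_smul, NormedSpace.exp_zero, Matrix.one_apply]
    rw [Finset.prod_ite_zero]
    simp only [Finset.prod_const_one]
    refine if_congr ?_ rfl rfl
    constructor
    · intro h
      funext y
      by_cases hy : y = x
      · subst hy; simp
      · simp [hy, h y (by simp [hy])]
    · intro h y hy
      have hy' : y ≠ x := by simpa using hy
      rw [h]; simp [hy']
  simp only [hprod, smul_eq_mul, ite_mul, one_mul, zero_mul]
  rw [← Finset.sum_filter]
  refine Finset.sum_bij' (fun J _ => J x) (fun b _ => Function.update I x b) ?_ ?_ ?_ ?_ ?_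
  · simp
  · simp
  · intro J hJ; exact (by simpa using hJ : J = _).symm
  · simp
  · intro J hJ
    have : J = Function.update I x (J x) := by simpa using hJ
    rw [← this]

theorem IsOrthInvariant.sum_update_comm {ι : Type} [Fintype ι] [DecidableEq ι] {d : ℕ}
    {T : (ι → Fin d) → ℝ} (hT : IsOrthInvariant T) (a b : Fin d) (I : ι → Fin d) :
    ∑ x, (if I x = a then T (Function.update I x b) else 0) =
      ∑ x, if I x = b then T (Function.update I x a) else 0 := by
  have h := hT.sum_skew (Matrix.single a b 1 - Matrix.single b a 1)
    (by simp [Matrix.transpose_sub]) I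
  rw [← sub_eq_zero, ← Finset.sum_sub_distrib]
  refine Eq.trans ?_ h
  refine Finset.sum_congr rfl fun x _ => ?_
  simp only [Matrix.sub_apply, sub_mul, Finset.sum_sub_distrib, Matrix.single_apply, ite_mul,
    one_mul, zero_mul]
  congr 1
  · by_cases hx : I x = a
    · simp [hx]
    · simp [hx, Ne.symm hx]
  · by_cases hx : I x = b
    · simp [hx]
    · simp [hx, Ne.symm hx]

/-- A nonzero coefficient of an invariant tensor uses every index an even number of times. -/
theorem IsOrthInvariant.even_card {ι : Type} [Fintype ι] [DecidableEq ι] {d : ℕ}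
    {T : (ι → Fin d) → ℝ} (hT : IsOrthInvariant T) {I : ι → Fin d} (hI : T I ≠ 0) (a : Fin d) :
    Even (Finset.univ.filter fun x => I x = a).card := by
  set v : Fin d → ℝ := fun b => if b = a then -1 else 1 with hv
  have hmem : Matrix.diagonal v ∈ Matrix.orthogonalGroup (Fin d) ℝ := by
    rw [Matrix.mem_orthogonalGroup_iff, Matrix.diagonal_transpose,
      Matrix.diagonal_mul_diagonal, ← Matrix.diagonal_one]
    congr 1
    funext b
    by_cases hb : b = a <;> simp [hv, hb]
  have h := hT _ hmem I
  rw [Finset.sum_eq_single I] at h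
  · simp only [Matrix.diagonal_apply_eq, hv, Finset.prod_ite, Finset.prod_const, one_pow,
      mul_one] at h
    have h1 : (-1 : ℝ) ^ (Finset.univ.filter fun x => I x = a).card = 1 := by
      exact mul_right_cancel₀ hI (by rw [h, one_mul])
    exact (neg_one_pow_eq_one_iff_even (by norm_num)).1 h1
  · intro J _ hJ
    obtain ⟨x, hx⟩ := Function.ne_iff.1 hJ
    have h0 : Matrix.diagonal v (I x) (J x) = 0 := Matrix.diagonal_apply_ne _ hx.symm
    exact mul_eq_zero_of_left (Finset.prod_eq_zero (Finset.mem_univ x) h0) _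
  · simp

/-- Prepend two values to a multi-index. -/
def optionCons₂ {κ α : Type} (a b : α) (j : κ → α) : Option (Option κ) → α
  | none => a
  | some none => b
  | some (some x) => j x

theorem sum_optionCons₂ {κ α : Type} [Fintype κ] [DecidableEq κ] [Fintype α]
    (F : (Option (Option κ) → α) → ℝ) :
    ∑ I, F I = ∑ a, ∑ b, ∑ j, F (optionCons₂ a b j) := by
  have hbij : Function.Bijective
      fun p : (α × α) × (κ → α) => optionCons₂ p.1.1 p.1.2 p.2 := by
    refine ⟨?_, ?_⟩
    · rintro ⟨⟨a, b⟩, j⟩ ⟨⟨a', b'⟩, j'⟩ h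
      have h1 := congrFun h none
      have h2 := congrFun h (some none)
      have h3 : j = j' := funext fun x => congrFun h (some (some x))
      simp only [optionCons₂] at h1 h2
      rw [h1, h2, h3]
    · intro I
      refine ⟨⟨⟨I none, I (some none)⟩, fun x => I (some (some x))⟩, ?_⟩
      funext x
      rcases x with _ | _ | x <;> rfl
  rw [← Fintype.sum_bijective _ hbij _ F fun _ => rfl, Fintype.sum_prod_type,
    Fintype.sum_prod_type]

/-- Contraction of a tensor in its first two arguments. -/
def contract₂ {κ : Type} {d : ℕ} (T : (Option (Option κ) → Fin d) → ℝ) (j : κ → Fin d) : ℝ :=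
  ∑ a, T (optionCons₂ a a j)

theorem sum_mul_apply_of_mem_orthogonalGroup {d : ℕ} {g : Matrix (Fin d) (Fin d) ℝ}
    (hg : g ∈ Matrix.orthogonalGroup (Fin d) ℝ) (b c : Fin d) :
    ∑ a, g a b * g a c = if b = c then 1 else 0 := by
  have := congrFun (congrFun ((Matrix.mem_orthogonalGroup_iff' _ _).1 hg) b) c
  simpa [Matrix.mul_apply, Matrix.one_apply] using this

theorem IsOrthInvariant.contract₂ {κ : Type} [Fintype κ] [DecidableEq κ] {d : ℕ}
    {T : (Option (Option κ) → Fin d) → ℝ} (hT : IsOrthInvariant T) :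
    IsOrthInvariant (contract₂ T) := by
  intro g hg I
  have hexp : ∀ a, T (optionCons₂ a a I) = ∑ b, ∑ c, ∑ J,
      (g a b * g a c) * ((∏ x, g (I x) (J x)) * T (optionCons₂ b c J)) := by
    intro a
    rw [← hT g hg, sum_optionCons₂]
    refine Finset.sum_congr rfl fun b _ => Finset.sum_congr rfl fun c _ =>
      Finset.sum_congr rfl fun J _ => ?_
    simp only [Fintype.prod_option, optionCons₂]
    ring
  symm
  calc ∑ a, T (optionCons₂ a a I)
      = ∑ b, ∑ c, ∑ J, (∑ a, g a b * g a c) *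
          ((∏ x, g (I x) (J x)) * T (optionCons₂ b c J)) := by
        simp_rw [hexp, Finset.sum_mul]
        rw [Finset.sum_comm]
        refine Finset.sum_congr rfl fun b _ => ?_
        rw [Finset.sum_comm]
        refine Finset.sum_congr rfl fun c _ => ?_
        rw [Finset.sum_comm]
    _ = ∑ J, (∏ x, g (I x) (J x)) * ∑ c, T (optionCons₂ c c J) := by
        simp_rw [sum_mul_apply_of_mem_orthogonalGroup hg, Finset.mul_sum]
        rw [Finset.sum_comm (γ := κ → Fin d)]
        refine Finset.sum_congr rfl fun b _ => ?_
        simp [ite_mul, Finset.sum_ite_irrel]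

theorem IsOrthInvariant.comp_equiv {ι κ : Type} [Fintype ι] [DecidableEq ι] [Fintype κ]
    [DecidableEq κ] {d : ℕ} {T : (ι → Fin d) → ℝ} (hT : IsOrthInvariant T) (e : κ ≃ ι) :
    IsOrthInvariant fun J : κ → Fin d => T (J ∘ e.symm) := by
  intro g hg I
  simp only
  rw [← hT g hg (I ∘ e.symm)]
  refine Fintype.sum_equiv (e.arrowCongr (Equiv.refl (Fin d))) _ _ fun J => ?_
  have : e.arrowCongr (Equiv.refl (Fin d)) J = J ∘ e.symm := rfl
  rw [this, ← Equiv.prod_comp e.symm]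
  rfl

/-- `T` is orthogonal to the tensors attached to all pair partitions of the index set. -/
def IsOrthogonalToPairings {ι : Type} [Fintype ι] [DecidableEq ι] {d : ℕ}
    (T : (ι → Fin d) → ℝ) : Prop :=
  ∀ m : Equiv.Perm ι, (∀ x, m (m x) = x) → (∀ x, m x ≠ x) → ∑ I, pairTensor m I * T I = 0

theorem IsOrthogonalToPairings.contract₂ {κ : Type} [Fintype κ] [DecidableEq κ] {d : ℕ}
    {T : (Option (Option κ) → Fin d) → ℝ} (hT : IsOrthogonalToPairings T) :
    IsOrthogonalToPairings (contract₂ T) := by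
  intro m hm hm'
  let f : Option (Option κ) → Option (Option κ)
    | none => some none
    | some none => none
    | some (some x) => some (some (m x))
  have hf : Function.Involutive f := by
    rintro (_ | _ | x)
    · rfl
    · rfl
    · simp [f, hm]
  have h := hT (hf.toPerm f) (fun x => hf x) (by rintro (_ | _ | x) <;> simp [f, hm'])
  rw [sum_optionCons₂] at h
  rw [← h]
  have hpair : ∀ (b c : Fin d) (j : κ → Fin d), pairTensor (hf.toPerm f) (optionCons₂ b c j) =
      if b = c then pairTensor m j else 0 := by
    intro b c j
    have hiff : (∀ x, optionCons₂ b c j ((hf.toPerm f) x) = optionCons₂ b c j x) ↔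
        b = c ∧ ∀ x, j (m x) = j x := by
      constructor
      · intro H
        exact ⟨H (some none), fun x => H (some (some x))⟩
      · rintro ⟨rfl, H⟩ (_ | _ | x)
        · rfl
        · rfl
        · exact H x
    unfold pairTensor
    rw [← ite_and]
    split_ifs with h1 h2 h2
    · rfl
    · exact absurd (hiff.1 h1) h2
    · exact absurd (hiff.2 h2) h1
    · rfl
  simp only [hpair, _root_.contract₂, Finset.mul_sum]
  rw [Finset.sum_comm]
  refine Finset.sum_congr rfl fun b _ => ?_
  simp [ite_mul, Finset.sum_ite_irrel]

theorem IsOrthogonalToPairings.comp_equiv {ι κ : Type} [Fintype ι] [DecidableEq ι] [Fintype κ]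
    [DecidableEq κ] {d : ℕ} {T : (ι → Fin d) → ℝ} (hT : IsOrthogonalToPairings T) (e : κ ≃ ι) :
    IsOrthogonalToPairings fun J : κ → Fin d => T (J ∘ e.symm) := by
  intro m hm hm'
  rw [← hT (e.permCongr m) (by simp [hm]) (by
    intro x hx
    exact hm' (e.symm x) (by simpa [Equiv.symm_apply_eq] using congrArg e.symm hx))]
  refine Fintype.sum_equiv (e.arrowCongr (Equiv.refl (Fin d))) _ _ fun J => ?_
  have : e.arrowCongr (Equiv.refl (Fin d)) J = J ∘ e.symm := rfl
  rw [this]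
  congr 1
  unfold pairTensor
  congr 1
  rw [eq_iff_iff, ← e.forall_congr_right (q := fun x => (J ∘ e.symm) (e.permCongr m x) = _)]
  simp

/-- First fundamental theorem for `O(d)`: an invariant tensor orthogonal to all pairing tensors
vanishes. -/
theorem IsOrthInvariant.eq_zero {d : ℕ} (N : ℕ) : ∀ {ι : Type} [Fintype ι] [DecidableEq ι]
    {T : (ι → Fin d) → ℝ}, Fintype.card ι = N → IsOrthInvariant T → IsOrthogonalToPairings T →
    T = 0 := by
  induction N using Nat.strong_induction_on with
  | _ N ih =>
    intro ι _ _ T hN hT hP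
    rcases isEmpty_or_nonempty ι with hι | hι
    · funext I
      have h := hP 1 (fun x => rfl) (fun x => (hι.false x).elim)
      rw [Fintype.sum_unique] at h
      rw [Subsingleton.elim I default]
      simpa [pairTensor] using h
    · refine tensor_eq_zero_of_traceless T hT.sum_update_comm ?_ fun I hI => hT.even_card hI
      intro I x y hxy
      let y' : {z // z ≠ x} := ⟨y, hxy.symm⟩
      let e : Option (Option {w : {z // z ≠ x} // w ≠ y'}) ≃ ι :=
        (Equiv.optionCongr (Equiv.optionSubtypeNe y')).trans (Equiv.optionSubtypeNe x)
      have hcard : Fintype.card {w : {z // z ≠ x} // w ≠ y'} < N := by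
        have := Fintype.card_congr e
        simp only [Fintype.card_option] at this
        omega
      have h0 := ih _ hcard rfl (hT.comp_equiv e).contract₂ (hP.comp_equiv e).contract₂
      have h1 := congrFun h0 fun w => I w.1.1
      rw [← Pi.zero_apply (M := fun _ => ℝ) (fun w : {w : {z // z ≠ x} // w ≠ y'} => I w.1.1), ← h1]
      refine Finset.sum_congr rfl fun a _ => ?_
      congr 1
      funext z
      obtain ⟨w, rfl⟩ := e.surjective z
      simp only [Function.comp_apply, Equiv.symm_apply_apply]
      rcases w with _ | _ | w
      · have : e none = x := by simp [e]
        rw [this]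
        simp [optionCons₂, Function.update_of_ne hxy]
      · have : e (some none) = y := by simp [e, y']
        rw [this]
        simp [optionCons₂]
      · have : e (some (some w)) = w.1.1 := by simp [e]
        rw [this]
        have h2 : w.1.1 ≠ y := fun h => w.2 (Subtype.ext h)
        simp [optionCons₂, Function.update_of_ne h2, Function.update_of_ne w.1.2]

/-- A fixed-point-free involution is conjugate to `Bool.not` acting on the fibres of `R × Bool`. -/
theorem exists_equiv_prod_bool {Q : Type} [Fintype Q] (τ : Equiv.Perm Q) (h : ∀ x, τ (τ x) = x)
    (h' : ∀ x, τ x ≠ x) :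
    ∃ (R : Type) (_ : Fintype R) (e : R × Bool ≃ Q), ∀ r b, τ (e (r, b)) = e (r, !b) := by
  classical
  let s : Setoid Q :=
    { r := fun x y => y = x ∨ y = τ x
      iseqv := by
        refine ⟨fun x => Or.inl rfl, ?_, ?_⟩
        · rintro x y (rfl | rfl)
          · exact Or.inl rfl
          · exact Or.inr (h x).symm
        · rintro x y z (rfl | rfl) (rfl | rfl)
          · exact Or.inl rfl
          · exact Or.inr rfl
          · exact Or.inr rfl
          · exact Or.inl (h x) }
  have hout : ∀ x : Q, x = (Quotient.mk s x).out ∨ x = τ (Quotient.mk s x).out :=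
    fun x => Quotient.mk_out (s := s) x
  have hτ : ∀ x, Quotient.mk s (τ x) = Quotient.mk s x := fun x =>
    Quotient.sound (s := s) (show x = τ x ∨ x = τ (τ x) from Or.inr (h x).symm)
  let f : Quotient s × Bool → Q := fun q => if q.2 then q.1.out else τ q.1.out
  have hmk : ∀ q, Quotient.mk s (f q) = q.1 := by
    rintro ⟨r, b⟩
    cases b <;> simp [f, hτ]
  have hf : Function.Bijective f := by
    refine ⟨?_, fun x => ?_⟩
    · rintro ⟨r, b⟩ ⟨r', b'⟩ hq
      have h1 : r = r' := by simpa only [hmk] using congrArg (Quotient.mk s) hq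
      subst h1
      cases b <;> cases b' <;> simp [f, h', (h' _).symm] at hq ⊢
    · rcases hout x with hx | hx
      · exact ⟨(Quotient.mk s x, true), hx.symm⟩
      · exact ⟨(Quotient.mk s x, false), hx.symm⟩
  refine ⟨Quotient s, inferInstance, Equiv.ofBijective f hf, fun r b => ?_⟩
  cases b <;> simp [f, h]

theorem sum_pairTensor_mul {Q R α : Type} [Fintype Q] [DecidableEq Q] [Fintype R] [DecidableEq R]
    [Fintype α] {τ : Equiv.Perm Q} (e : R × Bool ≃ Q)
    (he : ∀ r b, τ (e (r, b)) = e (r, !b)) (F : (Q → α) → ℝ) :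
    ∑ J, pairTensor τ J * F J = ∑ c : R → α, F fun x => c (e.symm x).1 := by
  classical
  unfold pairTensor
  simp only [ite_mul, one_mul, zero_mul]
  rw [← Finset.sum_filter]
  have hJ : ∀ J : Q → α, (∀ x, J (τ x) = J x) → (fun x => J (e ((e.symm x).1, true))) = J := by
    intro J h
    funext x
    obtain ⟨⟨r, b⟩, rfl⟩ := e.surjective x
    cases b
    · simpa [he] using h (e (r, false))
    · simp
  refine Finset.sum_bij' (fun J _ r => J (e (r, true))) (fun c _ x => c (e.symm x).1) ?_ ?_ ?_ ?_ ?_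
  · simp
  · intro c _
    simp only [Finset.mem_filter, Finset.mem_univ, true_and]
    intro x
    obtain ⟨⟨r, b⟩, rfl⟩ := e.surjective x
    simp [he]
  · intro J hJ'
    exact hJ J (by simpa using hJ')
  · intro c _
    simp
  · intro J hJ'
    exact congrArg F (hJ J (by simpa using hJ')).symm

theorem pairTensor_isOrthInvariant {ι : Type} [Fintype ι] [DecidableEq ι] {d : ℕ}
    {m : Equiv.Perm ι} (hm : ∀ x, m (m x) = x) (hm' : ∀ x, m x ≠ x) :
    IsOrthInvariant (d := d) (pairTensor m) := by
  classical
  intro g hg I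
  obtain ⟨R, _, e, he⟩ := exists_equiv_prod_bool m hm hm'
  simp_rw [mul_comm _ (pairTensor m _)]
  rw [sum_pairTensor_mul e he fun J => ∏ x, g (I x) (J x)]
  have hgT : ∀ b c, ∑ a, g b a * g c a = if b = c then 1 else 0 := by
    intro b c
    have := congrFun (congrFun ((Matrix.mem_orthogonalGroup_iff _ _).1 hg) b) c
    simpa [Matrix.mul_apply, Matrix.one_apply] using this
  have hprod : ∀ c : R → Fin d, ∏ x, g (I x) (c (e.symm x).1) =
      ∏ r, (g (I (e (r, true))) (c r) * g (I (e (r, false))) (c r)) := by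
    intro c
    rw [← Equiv.prod_comp e, Fintype.prod_prod_type]
    simp
  simp_rw [hprod]
  rw [← Fintype.piFinset_univ, ← Finset.prod_univ_sum (fun _ : R => (Finset.univ : Finset (Fin d)))
    fun r a => g (I (e (r, true))) a * g (I (e (r, false))) a]
  simp_rw [hgT]
  rw [Finset.prod_ite_zero]
  unfold pairTensor
  simp only [Finset.prod_const_one, Finset.mem_univ, true_implies]
  have hiff : (∀ r, I (e (r, true)) = I (e (r, false))) ↔ ∀ x, I (m x) = I x := by
    constructor
    · intro H x
      obtain ⟨⟨r, b⟩, rfl⟩ := e.surjective x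
      cases b <;> simp [he, H]
    · intro H r
      have := H (e (r, false))
      rwa [he] at this
  split_ifs with h1 h2 h2
  · rfl
  · exact absurd (hiff.1 h1) h2
  · exact absurd (hiff.2 h2) h1
  · rfl

theorem card_quotient_sameCycle {N : ℕ} (σ : Equiv.Perm (Fin N))
    [Fintype (Quotient (Equiv.Perm.SameCycle.setoid σ))] :
    Fintype.card (Quotient (Equiv.Perm.SameCycle.setoid σ)) = cycleCount σ := by
  classical
  have hout : ∀ x, σ.SameCycle (Quotient.mk (Equiv.Perm.SameCycle.setoid σ) x).out x :=
    fun x => Quotient.mk_out (s := Equiv.Perm.SameCycle.setoid σ) x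
  have hinj : ∀ q q' : Quotient (Equiv.Perm.SameCycle.setoid σ),
      σ.SameCycle q.out q'.out → q = q' := fun q q' h => by
    rw [← Quotient.out_eq q, ← Quotient.out_eq q']
    exact Quotient.sound h
  rw [← Finset.card_univ, ← Finset.card_filter_add_card_filter_not
    (fun q : Quotient (Equiv.Perm.SameCycle.setoid σ) => q.out ∈ σ.support), cycleCount]
  congr 1
  · rw [Equiv.Perm.cycleType_def, Multiset.card_map]
    refine Finset.card_bij (fun q _ => σ.cycleOf q.out) ?_ ?_ ?_
    · intro q hq
      exact Equiv.Perm.cycleOf_mem_cycleFactorsFinset_iff.2 (by simpa using hq)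
    · intro q hq q' hq' h
      exact hinj q q' ((Equiv.Perm.sameCycle_iff_cycleOf_eq_of_mem_support
        (Finset.mem_filter.1 hq).2 (Finset.mem_filter.1 hq').2).2 h)
    · intro c hc
      obtain ⟨x, hx⟩ := (Equiv.Perm.mem_cycleFactorsFinset_iff.1 hc).1.nonempty_support
      have hcx := Equiv.Perm.cycle_is_cycleOf hx hc
      refine ⟨Quotient.mk _ x, ?_, ?_⟩
      · simp only [Finset.mem_filter, Finset.mem_univ, true_and]
        rw [(hout x).mem_support_iff]
        exact Equiv.Perm.mem_cycleFactorsFinset_support_le hc hx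
      · rw [hcx]
        exact (hout x).cycleOf_eq
  · refine Finset.card_bij (fun q _ => q.out) ?_ (fun q _ q' _ h => ?_) ?_
    · intro q hq
      simpa using hq
    · exact hinj q q' (by rw [h])
    · intro x hx
      have hx' : σ x = x := by simpa using hx
      have h1 : (Quotient.mk (Equiv.Perm.SameCycle.setoid σ) x).out = x := by
        obtain ⟨i, hi⟩ := (hout x).symm
        rw [← hi]
        exact Equiv.Perm.zpow_apply_eq_self_of_apply_eq_self hx' i
      exact ⟨Quotient.mk _ x, by simp [h1, hx'], h1⟩

theorem sum_pairTensor_mul_pairTensor {N k : ℕ} (m p : Matchings N) :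
    ∑ J : Fin N → Fin k, pairTensor m.1 J * pairTensor p.1 J = (k : ℝ) ^ loopCount m p := by
  classical
  obtain ⟨m, hm, hm'⟩ := m
  obtain ⟨p, hp, hp'⟩ := p
  simp only [loopCount]
  set σ := m * p with hσ
  have hsemi : SemiconjBy m σ σ⁻¹ := by
    ext x
    have h1 : m⁻¹ = m := Equiv.ext fun x => by rw [Equiv.Perm.inv_eq_iff_eq, hm]
    have h2 : p⁻¹ = p := Equiv.ext fun x => by rw [Equiv.Perm.inv_eq_iff_eq, hp]
    simp [hσ, h1, h2, hm]
  have hzpow : ∀ (i : ℤ) x, m ((σ ^ i) x) = (σ ^ (-i)) (m x) := by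
    intro i x
    have := congrArg (fun f : Equiv.Perm (Fin N) => f x) (hsemi.zpow_right i).eq
    simpa using this
  let s := Equiv.Perm.SameCycle.setoid σ
  let t : Quotient s → Quotient s := Quotient.map m fun x y ⟨i, hi⟩ =>
    ⟨-i, by rw [← hzpow, hi]⟩
  have ht : Function.Involutive t := by
    intro q
    induction q using Quotient.inductionOn with
    | h x => simp [t, hm]
  have ht' : ∀ q, t q ≠ q := by
    intro q
    induction q using Quotient.inductionOn with
    | h x =>
      intro h
      obtain ⟨j, hj⟩ := (show σ.SameCycle (m x) x from Quotient.exact h).symm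
      obtain ⟨i, rfl | rfl⟩ := Int.even_or_odd' j
      · apply hm' ((σ ^ i) x)
        rw [hzpow, ← hj, ← Equiv.Perm.mul_apply, ← zpow_add]
        congr 2
        ring
      · apply hp' ((σ ^ i) x)
        apply m.injective
        change σ ((σ ^ i) x) = m ((σ ^ i) x)
        rw [hzpow, ← hj, ← Equiv.Perm.mul_apply, ← Equiv.Perm.mul_apply, ← zpow_add,
          ← zpow_one_add]
        congr 2
        ring
  obtain ⟨R, _, e, he⟩ := exists_equiv_prod_bool (ht.toPerm t) ht ht'
  have hcard : cycleCount σ / 2 = Fintype.card R := by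
    rw [← card_quotient_sameCycle, ← Fintype.card_congr e]
    simp
  have hiff : ∀ J : Fin N → Fin k, pairTensor m J * pairTensor p J =
      if (∀ x, J (m x) = J x) ∧ ∀ x, J (p x) = J x then 1 else 0 := by
    intro J
    unfold pairTensor
    split_ifs <;> simp_all
  have hq : ∑ F : Quotient s → Fin k, pairTensor (ht.toPerm t) F * 1 = (k : ℝ) ^ Fintype.card R := by
    rw [sum_pairTensor_mul e he fun _ => 1]
    simp
  have hfil : ∀ F : Quotient s → Fin k,
      pairTensor (ht.toPerm t) F * 1 = if ∀ q, F (t q) = F q then 1 else 0 := fun F => by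
    rw [mul_one]
    unfold pairTensor
    congr 1
  rw [hcard, ← hq]
  simp_rw [hiff, hfil]
  rw [← Finset.sum_filter, ← Finset.sum_filter]
  symm
  refine Finset.sum_bij (fun F _ x => F (Quotient.mk s x)) ?_ ?_ ?_ (fun _ _ => rfl)
  · intro F hF
    have hF' : ∀ q, F (t q) = F q := by simpa using hF
    simp only [Finset.mem_filter, Finset.mem_univ, true_and]
    refine ⟨fun x => hF' (Quotient.mk s x), fun x => ?_⟩
    rw [← hF' (Quotient.mk s (p x))]
    congr 1
    exact Quotient.sound (s := s) (show σ.SameCycle (m (p x)) x from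
      (Equiv.Perm.sameCycle_apply_left (f := σ)).2 (Equiv.Perm.SameCycle.refl σ x))
  · intro F _ F' _ h
    funext q
    induction q using Quotient.inductionOn with
    | h x => exact congrFun h x
  · intro J hJ
    obtain ⟨h1, h2⟩ : (∀ x, J (m x) = J x) ∧ ∀ x, J (p x) = J x := by simpa using hJ
    have hpow : ∀ (i : ℕ) x, J ((σ ^ i) x) = J x := by
      intro i
      induction i with
      | zero => simp
      | succ i ih =>
        intro x
        rw [pow_succ, Equiv.Perm.mul_apply, ih, hσ, Equiv.Perm.mul_apply, h1, h2]
    refine ⟨Quotient.lift J fun x y h => ?_, ?_, rfl⟩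
    · obtain ⟨i, _, hi⟩ := Equiv.Perm.SameCycle.exists_pow_eq' h
      rw [← hi, hpow]
    · simp only [Finset.mem_filter, Finset.mem_univ, true_and]
      intro q
      induction q using Quotient.inductionOn with
      | h x => exact h1 x

/-- The moments of the entries of a Haar-distributed orthogonal matrix, as a matrix. -/
noncomputable def momentMatrix {d : ℕ} (N : ℕ) (μ : Measure (OrthGroup d)) :
    Matrix (Fin N → Fin d) (Fin N → Fin d) ℝ :=
  fun I J => ∫ g, ∏ x, (g : Matrix (Fin d) (Fin d) ℝ) (I x) (J x) ∂μ

theorem integrable_prod_entries {d N : ℕ} (μ : Measure (OrthGroup d)) [IsProbabilityMeasure μ]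
    (I J : Fin N → Fin d) :
    Integrable (fun g : OrthGroup d => ∏ x, (g : Matrix (Fin d) (Fin d) ℝ) (I x) (J x)) μ := by
  have : BorelSpace (OrthGroup d) := ⟨rfl⟩
  have hcont : Continuous
      fun g : OrthGroup d => ∏ x, (g : Matrix (Fin d) (Fin d) ℝ) (I x) (J x) :=
    continuous_finsetProd _ fun x _ => continuous_subtype_val.matrix_elem _ _
  refine Integrable.of_bound hcont.aestronglyMeasurable 1 (Filter.Eventually.of_forall fun g => ?_)
  rw [norm_prod]
  exact Finset.prod_le_one (fun _ _ => norm_nonneg _)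
    fun x _ => entry_norm_bound_of_unitary g.2 (I x) (J x)

theorem momentMatrix_isOrthInvariant {d N : ℕ} (μ : Measure (OrthGroup d)) [μ.IsHaarMeasure]
    [IsProbabilityMeasure μ] (J : Fin N → Fin d) :
    IsOrthInvariant fun I => momentMatrix N μ I J := by
  have : BorelSpace (OrthGroup d) := ⟨rfl⟩
  intro h hh I
  simp only [momentMatrix]
  simp_rw [← integral_const_mul]
  rw [← integral_finsetSum _ fun K _ => (integrable_prod_entries μ K J).const_mul _]
  refine Eq.trans ?_ (integral_mul_left_eq_self (fun g : OrthGroup d =>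
    ∏ x, (g : Matrix (Fin d) (Fin d) ℝ) (I x) (J x)) (⟨h, hh⟩ : OrthGroup d))
  refine integral_congr_ae (Filter.Eventually.of_forall fun g => ?_)
  simp only [Submonoid.coe_mul, Matrix.mul_apply, ← Finset.prod_mul_distrib]
  rw [← Fintype.piFinset_univ, ← Finset.prod_univ_sum
    (fun _ : Fin N => (Finset.univ : Finset (Fin d)))
    fun x a => h (I x) a * (g : Matrix (Fin d) (Fin d) ℝ) a (J x)]

/-- The rectangular matrix whose rows are the tensors attached to pair partitions. -/
noncomputable def pairMatrix (d N : ℕ) : Matrix (Matchings N) (Fin N → Fin d) ℝ :=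
  fun m I => pairTensor m.1 I

theorem pairMatrix_mul_transpose (d n : ℕ) :
    pairMatrix d (2 * n) * (pairMatrix d (2 * n)).transpose = GramO d n := by
  ext m p
  simp only [Matrix.mul_apply, Matrix.transpose_apply, pairMatrix, GramO]
  exact sum_pairTensor_mul_pairTensor m p

theorem pairMatrix_mul_momentMatrix {d N : ℕ} (μ : Measure (OrthGroup d))
    [IsProbabilityMeasure μ] : pairMatrix d N * momentMatrix N μ = pairMatrix d N := by
  ext m J
  simp only [Matrix.mul_apply, pairMatrix, momentMatrix]
  simp_rw [← integral_const_mul]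
  rw [← integral_finsetSum _ fun I _ => (integrable_prod_entries μ I J).const_mul _]
  have hconst : ∀ g : OrthGroup d, ∑ I, pairTensor m.1 I *
      ∏ x, (g : Matrix (Fin d) (Fin d) ℝ) (I x) (J x) = pairTensor m.1 J := by
    intro g
    have hg : (star g : OrthGroup d).1 ∈ Matrix.orthogonalGroup (Fin d) ℝ := (star g).2
    rw [← pairTensor_isOrthInvariant m.2.1 m.2.2 _ hg J]
    exact Finset.sum_congr rfl fun I _ => mul_comm _ _
  simp [hconst]

/-- The Weingarten formula for the orthogonal group. -/
theorem momentMatrix_eq {d n : ℕ} (μ : Measure (OrthGroup d)) [μ.IsHaarMeasure]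
    [IsProbabilityMeasure μ] (W : Matrix (Matchings (2 * n)) (Matchings (2 * n)) ℝ)
    (hW : GramO d n * W * GramO d n = GramO d n) :
    momentMatrix (2 * n) μ =
      (pairMatrix d (2 * n)).transpose * (W * pairMatrix d (2 * n)) := by
  set V := pairMatrix d (2 * n) with hV
  have hVV : V * V.transpose = GramO d n := pairMatrix_mul_transpose d n
  have hGWV : GramO d n * W * V = V := by
    have h1 : (GramO d n * W - 1) * V = 0 := by
      rw [← Matrix.mul_self_mul_conjTranspose_eq_zero]
      rw [Matrix.sub_mul, Matrix.one_mul, Matrix.conjTranspose_eq_transpose_of_trivial, hVV, hW,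
        sub_self]
    rwa [Matrix.sub_mul, Matrix.one_mul, sub_eq_zero] at h1
  rw [← sub_eq_zero]
  set D := momentMatrix (2 * n) μ - V.transpose * (W * V) with hD
  have hVD : V * D = 0 := by
    rw [hD, Matrix.mul_sub, pairMatrix_mul_momentMatrix, ← Matrix.mul_assoc, hVV,
      ← Matrix.mul_assoc, hGWV, sub_self]
  ext I J
  have hinv : IsOrthInvariant fun I => D I J := by
    intro g hg I
    simp only [hD, Matrix.sub_apply, mul_sub, Finset.sum_sub_distrib]
    congr 1
    · exact momentMatrix_isOrthInvariant μ J g hg I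
    · simp only [Matrix.mul_apply (M := V.transpose), Matrix.transpose_apply, Finset.mul_sum]
      rw [Finset.sum_comm]
      refine Finset.sum_congr rfl fun m _ => ?_
      simp_rw [← mul_assoc]
      rw [← Finset.sum_mul]
      congr 1
      exact pairTensor_isOrthInvariant m.2.1 m.2.2 g hg I
  have hort : IsOrthogonalToPairings fun I => D I J := by
    intro m hm hm'
    exact congrFun (congrFun hVD (⟨m, hm, hm'⟩ : Matchings (2 * n))) J
  exact congrFun (IsOrthInvariant.eq_zero _ rfl hinv hort) I

theorem stmt10 (k d n : ℕ) (hk : 0 < k) (hn : 0 < n) (hkd : k ≤ d)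
    (μ : Measure (OrthGroup d)) [μ.IsHaarMeasure] [IsProbabilityMeasure μ]
    (W : Matrix (Matchings (2*n)) (Matchings (2*n)) ℝ)
    (hWsymm : W.IsSymm)
    (hW : GramO d n * W * GramO d n = GramO d n) :
    (∫ g, (∑ a : Fin k,
        (g : Matrix (Fin d) (Fin d) ℝ) (Fin.castLE hkd a) (Fin.castLE hkd a)) ^ (2*n) ∂μ) =
      ∑ m : Matchings (2*n), ∑ p : Matchings (2*n),
        W m p * (k : ℝ) ^ loopCount m p := by
  have hpow : ∀ g : OrthGroup d, (∑ a : Fin k,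
      (g : Matrix (Fin d) (Fin d) ℝ) (Fin.castLE hkd a) (Fin.castLE hkd a)) ^ (2*n) =
      ∑ J : Fin (2*n) → Fin k, ∏ x, (g : Matrix (Fin d) (Fin d) ℝ)
        ((Fin.castLE hkd ∘ J) x) ((Fin.castLE hkd ∘ J) x) := fun g => by
    rw [Fintype.sum_pow]
    rfl
  simp_rw [hpow]
  rw [integral_finsetSum _ fun J _ => integrable_prod_entries μ _ _]
  have hcast : ∀ (m : Matchings (2*n)) (J : Fin (2*n) → Fin k),
      pairTensor m.1 (Fin.castLE hkd ∘ J) = pairTensor m.1 J := by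
    intro m J
    simp [pairTensor]
  calc ∑ J : Fin (2*n) → Fin k,
        momentMatrix (2*n) μ (Fin.castLE hkd ∘ J) (Fin.castLE hkd ∘ J)
      = ∑ J : Fin (2*n) → Fin k, ∑ m : Matchings (2*n), ∑ p : Matchings (2*n),
          W m p * (pairTensor m.1 J * pairTensor p.1 J) := by
        refine Finset.sum_congr rfl fun J _ => ?_
        rw [momentMatrix_eq μ W hW]
        simp only [Matrix.mul_apply, Matrix.transpose_apply, pairMatrix, hcast, Finset.mul_sum]
        refine Finset.sum_congr rfl fun m _ => Finset.sum_congr rfl fun p _ => ?_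
        ring
    _ = ∑ m : Matchings (2*n), ∑ p : Matchings (2*n), W m p * (k : ℝ) ^ loopCount m p := by
        rw [Finset.sum_comm]
        refine Finset.sum_congr rfl fun m _ => ?_
        rw [Finset.sum_comm]
        refine Finset.sum_congr rfl fun p _ => ?_
        rw [← Finset.mul_sum, sum_pairTensor_mul_pairTensor]
end
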